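/- Let l ≥ 1 and q ≥ 2 be integers and set n = q(2l+1). Then the set { r > 0 | there exist p ∈ P_n and an inscribed equilateral (2l+1)-pointed star of side length r based at p } is exactly the closed interval [2·sin(πl/(2l+1))·cos(π/n), 2·sin(πl/(2l+1))]. In particular, every inscribed equilateral (2l+1)-pointed star in P_n has side length between 2·sin(πl/(2l+1))·cos(π/n) and 2·sin(πl/(2l+1)). -/

import Mathlib

noncomputable section

/-- The primitive `n`-th root of unity `ω = exp(2πi/n)`. -/
def nroot (n : ℕ) : ℂ := Complex.exp (2 * Real.pi * Complex.I / n)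

/-- The boundary of the regular `n`-gon inscribed in the unit circle, as a subset of `ℂ`:
the union of the closed segments from `ω^j` to `ω^(j+1)` for `j = 0, …, n-1`. -/
def polygon (n : ℕ) : Set ℂ :=
  ⋃ j ∈ Finset.range n, segment ℝ ((nroot n) ^ j) ((nroot n) ^ (j + 1))

/-- The critical scale `r_n`: `2 cos(π/n)` for even `n`,
and `1 + cos(2π/n)/cos(π/n)` for odd `n`. -/
def rpoly (n : ℕ) : ℝ :=
  if Even n then 2 * Real.cos (Real.pi / n)
  else 1 + Real.cos (2 * Real.pi / n) / Real.cos (Real.pi / n)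

/-- Arc-length parametrization of the polygon `P_n` by the parameter `t` (normalized so that
`t ∈ [0,1)` traverses the polygon once counterclockwise, with vertices at `t = j/n`). -/
def polyParam (n : ℕ) (t : ℝ) : ℂ :=
  ((1 - Int.fract (n * t) : ℝ) : ℂ) * (nroot n) ^ (⌊(n : ℝ) * t⌋) +
    ((Int.fract (n * t) : ℝ) : ℂ) * (nroot n) ^ (⌊(n : ℝ) * t⌋ + 1)

/-- The parameter value in `[0,1)` of a point `x ∈ P_n`. -/
def polyArg (n : ℕ) (x : ℂ) : ℝ :=
  sInf {t : ℝ | t ∈ Set.Ico (0 : ℝ) 1 ∧ polyParam n t = x}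

/-- The normalized counterclockwise arc distance from `x` to `y` along `P_n`: the length of the
counterclockwise path along `P_n` from `x` to `y` divided by the total perimeter of `P_n`. -/
def polyDist (n : ℕ) (x y : ℂ) : ℝ := Int.fract (polyArg n y - polyArg n x)

/-- `z` is strictly counterclockwise-between `x` and `y` on `P_n`. -/
def SCCWBtw (n : ℕ) (x z y : ℂ) : Prop :=
  0 < polyDist n x z ∧ polyDist n x z < polyDist n x y

/-- An inscribed equilateral `(2l+1)`-pointed star of side length `r` based at `p ∈ P_n`:
a tuple `(u 0, …, u (2l+1))` of points of `P_n` with `u 0 = u (2l+1) = p`, where consecutive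
points are at Euclidean distance `r`, every point of `P_n` strictly counterclockwise-between
`u i` and `u (i+1)` is at distance `< r` from `u i`, and the total winding number is `l`. -/
def IsStar (n l : ℕ) (r : ℝ) (p : ℂ) (u : ℕ → ℂ) : Prop :=
  u 0 = p ∧ u (2 * l + 1) = p ∧
  (∀ i ≤ 2 * l + 1, u i ∈ polygon n) ∧
  (∀ i ≤ 2 * l, dist (u i) (u (i + 1)) = r) ∧
  (∀ i ≤ 2 * l, ∀ z ∈ polygon n, SCCWBtw n (u i) z (u (i + 1)) → dist (u i) z < r) ∧
  (∑ i ∈ Finset.range (2 * l + 1), polyDist n (u i) (u (i + 1))) = (l : ℝ)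

/-- `x` is a vertex of `P_n`. -/
def IsVertex (n : ℕ) (x : ℂ) : Prop := ∃ j < n, x = (nroot n) ^ j

/-- `x` is the midpoint of an edge of `P_n`. -/
def IsMidpoint (n : ℕ) (x : ℂ) : Prop :=
  ∃ j < n, x = ((nroot n) ^ j + (nroot n) ^ (j + 1)) / 2

end

open Complex in
lemma nroot_zpow (n : ℕ) (k : ℤ) :
    nroot n ^ k = ⟨Real.cos (2 * k * (Real.pi / n)), Real.sin (2 * k * (Real.pi / n))⟩ := by
  have h : (k : ℂ) * (2 * Real.pi * I / n) = ((2 * k * (Real.pi / n) : ℝ) : ℂ) * I := by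
    push_cast; ring
  rw [nroot, ← Complex.exp_int_mul, h]
  apply Complex.ext
  · exact Complex.exp_ofReal_mul_I_re _
  · exact Complex.exp_ofReal_mul_I_im _

lemma nroot_ne_zero (n : ℕ) : nroot n ≠ 0 := Complex.exp_ne_zero _

lemma nroot_zpow_self {n : ℕ} (hn : n ≠ 0) : nroot n ^ (n : ℤ) = 1 := by
  have hn' : (n : ℂ) ≠ 0 := by exact_mod_cast hn
  rw [nroot, ← Complex.exp_int_mul, Int.cast_natCast, mul_div_cancel₀ _ hn',
    Complex.exp_two_pi_mul_I]

lemma norm_nroot_zpow (n : ℕ) (k : ℤ) : ‖nroot n ^ k‖ = 1 := by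
  have h : (2 * Real.pi * Complex.I / n : ℂ) = ((2 * Real.pi / n : ℝ) : ℂ) * Complex.I := by
    push_cast; ring
  rw [norm_zpow, nroot, h, Complex.norm_exp_ofReal_mul_I, one_zpow]

/-- The point of `P_n` reached from the vertex `1` after travelling `a` edge lengths
counterclockwise. -/
noncomputable def edgeParam (n : ℕ) (a : ℝ) : ℂ :=
  ((1 - Int.fract a : ℝ) : ℂ) * nroot n ^ ⌊a⌋ + ((Int.fract a : ℝ) : ℂ) * nroot n ^ (⌊a⌋ + 1)

lemma edgeParam_add_int (n : ℕ) (a : ℝ) (k : ℤ) :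
    edgeParam n (a + k) = nroot n ^ k * edgeParam n a := by
  simp only [edgeParam, Int.fract_add_intCast, Int.floor_add_intCast,
    zpow_add₀ (nroot_ne_zero n), zpow_one]
  ring

lemma edgeParam_add_mul {n : ℕ} (hn : n ≠ 0) (a : ℝ) (k : ℤ) :
    edgeParam n (a + n * k) = edgeParam n a := by
  have := edgeParam_add_int n a (n * k)
  rw [zpow_mul, nroot_zpow_self hn, one_zpow, one_mul] at this
  exact_mod_cast this

lemma edgeParam_eq_of_mem_Icc (n : ℕ) {b : ℝ} {k : ℤ} (hb : b ∈ Set.Icc (k : ℝ) (k + 1)) :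
    edgeParam n b = ((1 - (b - k) : ℝ) : ℂ) * nroot n ^ k +
      ((b - k : ℝ) : ℂ) * nroot n ^ (k + 1) := by
  rcases hb.2.eq_or_lt with h | h
  · have : edgeParam n b = nroot n ^ (k + 1) := by
      have h' : b = ((k + 1 : ℤ) : ℝ) := by push_cast; exact h
      rw [edgeParam, h']
      simp
    rw [this, h]
    simp
  · have hf : ⌊b⌋ = k := Int.floor_eq_iff.2 ⟨hb.1, h⟩
    rw [edgeParam, Int.fract, hf]

lemma edgeParam_mem_polygon {n : ℕ} (hn : n ≠ 0) (a : ℝ) : edgeParam n a ∈ polygon n := by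
  have hn' : (n : ℤ) ≠ 0 := by exact_mod_cast hn
  obtain ⟨j, hj⟩ := Int.eq_ofNat_of_zero_le (Int.emod_nonneg ⌊a⌋ hn')
  have hjn : j < n := by
    have := Int.emod_lt_of_pos ⌊a⌋ (by positivity : (0 : ℤ) < n)
    omega
  have hw : nroot n ^ ⌊a⌋ = nroot n ^ j := by
    rw [← Int.emod_add_mul_ediv ⌊a⌋ n, zpow_add₀ (nroot_ne_zero n), zpow_mul,
      nroot_zpow_self hn, one_zpow, mul_one, hj]
    exact zpow_natCast _ _
  refine Set.mem_biUnion (Finset.mem_coe.2 (Finset.mem_range.2 hjn)) ?_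
  refine ⟨1 - Int.fract a, Int.fract a, sub_nonneg.2 (Int.fract_lt_one a).le,
    Int.fract_nonneg a, by ring, ?_⟩
  rw [edgeParam, zpow_add₀ (nroot_ne_zero n), hw, pow_succ, zpow_one]
  simp [Complex.real_smul]

lemma exists_edgeParam_eq {n : ℕ} {z : ℂ} (hz : z ∈ polygon n) : ∃ a, edgeParam n a = z := by
  simp only [polygon, Set.mem_iUnion, exists_prop] at hz
  obtain ⟨j, -, s, t, hs, ht, hst, rfl⟩ := hz
  refine ⟨(j : ℤ) + t, ?_⟩
  rw [edgeParam_eq_of_mem_Icc n (k := j) ⟨by linarith, by linarith⟩]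
  have hj : nroot n ^ ((j : ℤ) + 1) = nroot n ^ (j + 1) := by
    rw [← Nat.cast_succ, zpow_natCast]
  rw [hj, zpow_natCast, add_sub_cancel_left, ← hst, add_sub_cancel_right]
  simp [Complex.real_smul]

lemma cos_sub_cos_two_mul_sub_one (α x : ℝ) :
    Real.cos α - Real.cos ((2 * x - 1) * α) = 2 * Real.sin (x * α) * Real.sin ((x - 1) * α) := by
  rw [Real.cos_sub_cos, show (α + (2 * x - 1) * α) / 2 = x * α by ring,
    show (α - (2 * x - 1) * α) / 2 = -((x - 1) * α) by ring, Real.sin_neg]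
  ring

lemma sin_mul_pi_div_nonneg {n : ℕ} {x : ℝ} (hx : 0 ≤ x) (hxn : x ≤ n) :
    0 ≤ Real.sin (x * (Real.pi / n)) := by
  rcases hx.eq_or_lt with rfl | h
  · simp
  have hn : (0 : ℝ) < n := h.trans_le hxn
  apply Real.sin_nonneg_of_nonneg_of_le_pi (by positivity)
  rw [← mul_div_assoc, div_le_iff₀ hn]
  nlinarith [Real.pi_pos]

lemma sin_mul_pi_div_pos {n : ℕ} {x : ℝ} (hx : 0 < x) (hxn : x < n) :
    0 < Real.sin (x * (Real.pi / n)) := by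
  have hn : (0 : ℝ) < n := hx.trans hxn
  apply Real.sin_pos_of_pos_of_lt_pi (by positivity)
  rw [← mul_div_assoc, div_lt_iff₀ hn]
  nlinarith [Real.pi_pos]

lemma cos_two_mul_sub_one_le {n : ℕ} {x : ℝ} (hx : 1 ≤ x) (hxn : x ≤ n) :
    Real.cos ((2 * x - 1) * (Real.pi / n)) ≤ Real.cos (Real.pi / n) := by
  have h1 := sin_mul_pi_div_nonneg (n := n) (x := x) (by linarith) hxn
  have h2 := sin_mul_pi_div_nonneg (n := n) (x := x - 1) (by linarith) (by linarith)
  have := cos_sub_cos_two_mul_sub_one (Real.pi / n) x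
  nlinarith [mul_nonneg h1 h2]

lemma cos_two_mul_sub_one_lt {n : ℕ} {x : ℝ} (hx : 1 < x) (hxn : x < n) :
    Real.cos ((2 * x - 1) * (Real.pi / n)) < Real.cos (Real.pi / n) := by
  have h1 := sin_mul_pi_div_pos (n := n) (x := x) (by linarith) hxn
  have h2 := sin_mul_pi_div_pos (n := n) (x := x - 1) (by linarith) (by linarith)
  have := cos_sub_cos_two_mul_sub_one (Real.pi / n) x
  nlinarith [mul_pos h1 h2]

/-- The linear functional taking the value `cos (π / n)` on the edge from `1` to `ω`,
evaluated along `P_n`. -/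
lemma edgeParam_re_mul_cos_add_im_mul_sin (n : ℕ) (a : ℝ) :
    (edgeParam n a).re * Real.cos (Real.pi / n) + (edgeParam n a).im * Real.sin (Real.pi / n) =
      (1 - Int.fract a) * Real.cos ((2 * ⌊a⌋ - 1) * (Real.pi / n)) +
        Int.fract a * Real.cos ((2 * (⌊a⌋ + 1 : ℝ) - 1) * (Real.pi / n)) := by
  simp only [sub_mul, one_mul, Real.cos_sub, edgeParam, nroot_zpow]
  simp
  ring

lemma eq_of_edgeParam_eq {n : ℕ} (hn : 3 ≤ n) {a b : ℝ} (ha : a ∈ Set.Ico (0 : ℝ) 1)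
    (hb : b ∈ Set.Ico (0 : ℝ) n) (hab : edgeParam n a = edgeParam n b) : a = b := by
  have hn' : (3 : ℝ) ≤ n := by exact_mod_cast hn
  have hfa : ⌊a⌋ = 0 := Int.floor_eq_zero_iff.2 ha
  have hfr : Int.fract a = a := Int.fract_eq_self.2 ha
  have hsin : 0 < Real.sin (2 * (Real.pi / n)) := sin_mul_pi_div_pos (by norm_num) (by linarith)
  have hima : (edgeParam n a).im = a * Real.sin (2 * (Real.pi / n)) := by
    simp only [edgeParam, hfa, hfr, nroot_zpow]
    simp
  have hfun : (edgeParam n a).re * Real.cos (Real.pi / n) +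
      (edgeParam n a).im * Real.sin (Real.pi / n) = Real.cos (Real.pi / n) := by
    rw [edgeParam_re_mul_cos_add_im_mul_sin, hfa, hfr]
    norm_num [Real.cos_neg]
    ring
  have hfun' := hfun
  rw [hab, edgeParam_re_mul_cos_add_im_mul_sin] at hfun'
  have h0 : 0 ≤ ⌊b⌋ := Int.floor_nonneg.2 hb.1
  have hbn : ⌊b⌋ + 1 ≤ (n : ℤ) := Int.add_one_le_iff.2 (Int.floor_lt.2 (by exact_mod_cast hb.2))
  have hτ0 := Int.fract_nonneg b
  have hτ1 := Int.fract_lt_one b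
  obtain h | h | h : ⌊b⌋ = 0 ∨ ⌊b⌋ = 1 ∨ 2 ≤ ⌊b⌋ := by omega
  · have himb : (edgeParam n b).im = Int.fract b * Real.sin (2 * (Real.pi / n)) := by
      simp only [edgeParam, h, nroot_zpow]
      simp
    have : a = Int.fract b := mul_right_cancel₀ hsin.ne' (by rw [← hima, hab, himb])
    rw [this, Int.fract, h]
    simp
  · have h3 := cos_two_mul_sub_one_lt (n := n) (x := 2) (by norm_num) (by linarith)
    rw [h] at hfun'
    norm_num at hfun' h3
    have hfb : Int.fract b = 0 := by
      have : Int.fract b * (Real.cos (Real.pi / n) - Real.cos (3 * (Real.pi / n))) = 0 := by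
        linarith
      exact (mul_eq_zero.1 this).resolve_right (sub_pos.2 h3).ne'
    have himb : (edgeParam n b).im = Real.sin (2 * (Real.pi / n)) := by
      simp only [edgeParam, h, hfb, nroot_zpow]
      simp
    have : a * Real.sin (2 * (Real.pi / n)) = Real.sin (2 * (Real.pi / n)) := by
      rw [← hima, hab, himb]
    nlinarith [ha.2]
  · have h2 : (2 : ℝ) ≤ ⌊b⌋ := by exact_mod_cast h
    have hbn' : (⌊b⌋ : ℝ) + 1 ≤ n := by exact_mod_cast hbn
    have h3 := cos_two_mul_sub_one_lt (n := n) (x := ⌊b⌋) (by linarith) (by linarith)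
    have h4 := cos_two_mul_sub_one_le (n := n) (x := ⌊b⌋ + 1) (by linarith) hbn'
    nlinarith [mul_pos (sub_pos.2 hτ1) (sub_pos.2 h3), mul_nonneg hτ0 (sub_nonneg.2 h4)]

lemma injOn_edgeParam {n : ℕ} (hn : 3 ≤ n) : Set.InjOn (edgeParam n) (Set.Ico 0 n) := by
  have key : ∀ a ∈ Set.Ico (0 : ℝ) n, ∀ b ∈ Set.Ico (0 : ℝ) n, ⌊a⌋ ≤ ⌊b⌋ →
      edgeParam n a = edgeParam n b → a = b := by
    intro a ha b hb hle hab
    have h0 : (0 : ℝ) ≤ ⌊a⌋ := by exact_mod_cast Int.floor_nonneg.2 ha.1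
    have hle' : (⌊a⌋ : ℝ) ≤ b := Int.le_floor.1 hle
    have := eq_of_edgeParam_eq hn (a := a + (-⌊a⌋ : ℤ)) (b := b + (-⌊a⌋ : ℤ))
      ⟨by push_cast; linarith [Int.floor_le a], by push_cast; linarith [Int.lt_floor_add_one a]⟩
      ⟨by push_cast; linarith, by push_cast; linarith [hb.2]⟩
      (by rw [edgeParam_add_int, edgeParam_add_int, hab])
    linarith
  intro a ha b hb hab
  rcases le_total ⌊a⌋ ⌊b⌋ with h | h
  · exact key a ha b hb h hab
  · exact (key b hb a ha h hab.symm).symm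

lemma polyArg_edgeParam {n : ℕ} (hn : 3 ≤ n) (a : ℝ) :
    polyArg n (edgeParam n a) = Int.fract (a / n) := by
  have hn0 : n ≠ 0 := by omega
  have hpos : (0 : ℝ) < n := by positivity
  have key : edgeParam n (n * Int.fract (a / n)) = edgeParam n a := by
    rw [← edgeParam_add_mul hn0 _ ⌊a / n⌋, ← mul_add, Int.fract_add_floor,
      mul_div_cancel₀ _ hpos.ne']
  have : {t : ℝ | t ∈ Set.Ico (0 : ℝ) 1 ∧ polyParam n t = edgeParam n a} =
      {Int.fract (a / n)} := by
    ext t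
    refine ⟨fun ⟨ht, h⟩ => ?_, ?_⟩
    · have h1 : edgeParam n (n * t) = edgeParam n (n * Int.fract (a / n)) := h.trans key.symm
      have hmem : ∀ s ∈ Set.Ico (0 : ℝ) 1, (n : ℝ) * s ∈ Set.Ico (0 : ℝ) n := fun s hs =>
        ⟨mul_nonneg hpos.le hs.1, by nlinarith [hs.2]⟩
      exact mul_left_cancel₀ hpos.ne' (injOn_edgeParam hn (hmem t ht)
        (hmem _ ⟨Int.fract_nonneg _, Int.fract_lt_one _⟩) h1)
    · rintro rfl
      exact ⟨⟨Int.fract_nonneg _, Int.fract_lt_one _⟩, key⟩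
  rw [polyArg, this, csInf_singleton]

lemma polyDist_edgeParam {n : ℕ} (hn : 3 ≤ n) (a b : ℝ) :
    polyDist n (edgeParam n a) (edgeParam n b) = Int.fract ((b - a) / n) := by
  rw [polyDist, polyArg_edgeParam hn, polyArg_edgeParam hn, Int.fract_eq_fract]
  refine ⟨⌊a / n⌋ - ⌊b / n⌋, ?_⟩
  simp only [Int.fract]
  push_cast
  ring

lemma edgeParam_add_polyDist {n : ℕ} (hn : 3 ≤ n) (a b : ℝ) :
    edgeParam n (a + n * polyDist n (edgeParam n a) (edgeParam n b)) = edgeParam n b := by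
  have hpos : (0 : ℝ) < n := by positivity
  rw [polyDist_edgeParam hn, ← edgeParam_add_mul (by omega) _ ⌊(b - a) / n⌋, add_assoc, ← mul_add,
    Int.fract_add_floor, mul_div_cancel₀ _ hpos.ne', add_sub_cancel]

/-- Squared distance between a point of the edge from `1` to `ω` and a point of the edge from
`ω ^ k` to `ω ^ (k + 1)`. -/
lemma dist_sq_edgeParam (n : ℕ) {a b : ℝ} {k : ℤ} (ha : a ∈ Set.Icc (0 : ℝ) 1)
    (hb : b ∈ Set.Icc (k : ℝ) (k + 1)) :
    dist (edgeParam n a) (edgeParam n b) ^ 2 =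
      2 - 2 * (a * (1 - a) + (b - k) * (1 - (b - k))) * (1 - Real.cos (2 * (Real.pi / n))) -
        2 * (((1 - a) * (1 - (b - k)) + a * (b - k)) * Real.cos (2 * k * (Real.pi / n)) +
          (1 - a) * (b - k) * Real.cos (2 * (k + 1) * (Real.pi / n)) +
          a * (1 - (b - k)) * Real.cos (2 * (k - 1) * (Real.pi / n))) := by
  have hea := edgeParam_eq_of_mem_Icc n (b := a) (k := 0) (by simpa using ha)
  rw [hea, edgeParam_eq_of_mem_Icc n hb, dist_eq_norm, ← Complex.normSq_eq_norm_sq,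
    Complex.normSq_apply]
  simp only [nroot_zpow]
  have e1 : 2 * ((k : ℝ) + 1) * (Real.pi / n) = 2 * k * (Real.pi / n) + 2 * (Real.pi / n) := by
    ring
  have e2 : 2 * ((k : ℝ) - 1) * (Real.pi / n) = 2 * k * (Real.pi / n) - 2 * (Real.pi / n) := by
    ring
  have h1 := Real.cos_sq_add_sin_sq (2 * (Real.pi / n))
  have h2 := Real.cos_sq_add_sin_sq (2 * k * (Real.pi / n))
  simp [e1, e2, Real.cos_add, Real.cos_sub, Real.sin_add]
  generalize Real.cos (2 * (Real.pi / n)) = c at *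
  generalize Real.sin (2 * (Real.pi / n)) = s at *
  generalize Real.cos (2 * k * (Real.pi / n)) = C at *
  generalize Real.sin (2 * k * (Real.pi / n)) = S at *
  generalize b - k = t at *
  grind

/-- As `z` runs along the edge from `ω ^ k` to `ω ^ (k + 1)`, it moves towards neither endpoint of
the edge from `1` to `ω`. -/
lemma cos_add_cos_sub_nonneg {n : ℕ} {x : ℝ} (hx : 0 ≤ x) (hxn : 2 * x + 2 ≤ n) :
    0 ≤ Real.cos (2 * (Real.pi / n)) - 1 - Real.cos (2 * (x + 1) * (Real.pi / n)) +
      Real.cos (2 * x * (Real.pi / n)) := by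
  have hs := sin_mul_pi_div_nonneg (n := n) (x := 1) (by norm_num) (by linarith)
  rw [one_mul] at hs
  have h1 := sin_mul_pi_div_nonneg (n := n) (x := x) hx (by linarith)
  have h2 := Real.cos_nonneg_of_neg_pi_div_two_le_of_le (x := (x + 1) * (Real.pi / n))
    (by have : 0 ≤ (x + 1) * (Real.pi / n) := by positivity
        linarith [Real.pi_pos])
    (by have hn : (0 : ℝ) < n := by linarith
        rw [← mul_div_assoc, div_le_iff₀ hn]
        nlinarith [Real.pi_pos])
  have key : Real.cos (2 * (Real.pi / n)) - 1 - Real.cos (2 * (x + 1) * (Real.pi / n)) +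
      Real.cos (2 * x * (Real.pi / n)) =
      4 * Real.sin (Real.pi / n) *
        (Real.sin (x * (Real.pi / n)) * Real.cos ((x + 1) * (Real.pi / n))) := by
    have e1 : 2 * (x + 1) * (Real.pi / n) = 2 * (x * (Real.pi / n) + Real.pi / n) := by ring
    have e2 : 2 * x * (Real.pi / n) = 2 * (x * (Real.pi / n)) := by ring
    have e3 : (x + 1) * (Real.pi / n) = x * (Real.pi / n) + Real.pi / n := by ring
    have h3 := Real.cos_sq_add_sin_sq (Real.pi / n)
    have h4 := Real.cos_sq_add_sin_sq (x * (Real.pi / n))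
    rw [e1, e2, e3, Real.cos_two_mul, Real.cos_two_mul, Real.cos_two_mul, Real.cos_add]
    generalize Real.cos (x * (Real.pi / n)) = C at *
    generalize Real.sin (x * (Real.pi / n)) = S at *
    generalize Real.cos (Real.pi / n) = c at *
    generalize Real.sin (Real.pi / n) = s at *
    grind
  rw [key]
  positivity

lemma strictMonoOn_dist_edgeParam_edge {n : ℕ} (hn : 3 ≤ n) {a : ℝ} {k : ℤ}
    (ha : a ∈ Set.Icc (0 : ℝ) 1) (hk : 1 ≤ k) (hkn : 2 * k + 2 ≤ n) :
    StrictMonoOn (fun b => dist (edgeParam n a) (edgeParam n b)) (Set.Icc (k : ℝ) (k + 1)) := by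
  intro b hb b' hb' hlt
  have hk' : (1 : ℝ) ≤ k := by exact_mod_cast hk
  have hkn' : (2 * k + 2 : ℝ) ≤ n := by exact_mod_cast hkn
  have h1 := cos_add_cos_sub_nonneg (n := n) (x := k) (by linarith) hkn'
  have h2 := cos_add_cos_sub_nonneg (n := n) (x := k - 1) (by linarith) (by linarith)
  rw [sub_add_cancel] at h2
  have h3 := cos_two_mul_sub_one_lt (n := n) (x := 3 / 2) (by norm_num)
    (by have : (3 : ℝ) ≤ n := by exact_mod_cast hn
        linarith)
  norm_num at h3
  have hc : 0 < 1 - Real.cos (2 * (Real.pi / n)) := by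
    linarith [Real.cos_le_one (Real.pi / n)]
  refine lt_of_pow_lt_pow_left₀ 2 dist_nonneg ?_
  beta_reduce
  rw [dist_sq_edgeParam n ha hb, dist_sq_edgeParam n ha hb', ← sub_pos]
  have e : ∀ c C C₁ C₂ : ℝ,
      2 - 2 * (a * (1 - a) + (b' - k) * (1 - (b' - k))) * (1 - c) -
        2 * (((1 - a) * (1 - (b' - k)) + a * (b' - k)) * C +
          (1 - a) * (b' - k) * C₁ + a * (1 - (b' - k)) * C₂) -
      (2 - 2 * (a * (1 - a) + (b - k) * (1 - (b - k))) * (1 - c) -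
        2 * (((1 - a) * (1 - (b - k)) + a * (b - k)) * C +
          (1 - a) * (b - k) * C₁ + a * (1 - (b - k)) * C₂)) =
      2 * (b' - b) * ((1 - a) * (c - 1 - C₁ + C) + a * (c - 1 - C + C₂) +
        ((b - k) + (b' - k)) * (1 - c)) := by
    intros; ring
  rw [e]
  have hb0 : 0 < (b - k) + (b' - k) := by linarith [hb.1]
  have := mul_nonneg (sub_nonneg.2 ha.2) h1
  have := mul_nonneg ha.1 h2
  have := mul_pos hb0 hc
  exact mul_pos (by linarith) (by linarith)

lemma strictMonoOn_dist_edgeParam_initial {n : ℕ} (hn : 3 ≤ n) {a : ℝ}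
    (ha : a ∈ Set.Icc (0 : ℝ) 1) :
    StrictMonoOn (fun b => dist (edgeParam n a) (edgeParam n b)) (Set.Icc a 1) := by
  have hω : nroot n ≠ 1 := by
    intro h
    have h0 := nroot_zpow n 1
    have hn' : (3 : ℝ) ≤ n := by exact_mod_cast hn
    have := sin_mul_pi_div_pos (n := n) (x := 2) (by norm_num) (by linarith)
    rw [zpow_one, h] at h0
    have := congrArg Complex.im h0
    norm_num at this
    linarith
  have key : ∀ b ∈ Set.Icc a 1,
      dist (edgeParam n a) (edgeParam n b) = (b - a) * ‖nroot n - 1‖ := by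
    intro b hb
    have hb' : b ∈ Set.Icc ((0 : ℤ) : ℝ) ((0 : ℤ) + 1) := by
      simpa using ⟨ha.1.trans hb.1, hb.2⟩
    rw [edgeParam_eq_of_mem_Icc n hb', edgeParam_eq_of_mem_Icc n (k := 0) (by simpa using ha),
      dist_comm, dist_eq_norm, ← Real.norm_of_nonneg (sub_nonneg.2 hb.1), ← Complex.norm_real,
      ← norm_mul]
    congr 1
    simp
    ring
  intro b hb b' hb' hlt
  beta_reduce
  rw [key b hb, key b' hb']
  exact mul_lt_mul_of_pos_right (by linarith) (norm_pos_iff.2 (sub_ne_zero.2 hω))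

lemma strictMonoOn_dist_edgeParam {n : ℕ} (hn : 3 ≤ n) {a : ℝ} (ha : a ∈ Set.Icc (0 : ℝ) 1)
    (k : ℕ) (hkn : 2 * k + 2 ≤ n) :
    StrictMonoOn (fun b => dist (edgeParam n a) (edgeParam n b)) (Set.Icc a (k + 1)) := by
  induction k with
  | zero => simpa using strictMonoOn_dist_edgeParam_initial hn ha
  | succ k ih =>
    have h := strictMonoOn_dist_edgeParam_edge hn (a := a) (k := k + 1) ha (by omega)
      (by omega)
    have hle : a ≤ k + 1 := ha.2.trans (by simp)
    have hle' : (k + 1 : ℝ) ≤ k + 1 + 1 := by simp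
    push_cast at h ⊢
    rw [← Set.Icc_union_Icc_eq_Icc hle hle']
    exact (ih (by omega)).union h (isGreatest_Icc hle) (isLeast_Icc hle')

/-- Moving counterclockwise by at most `m` edge lengths, where `2 * (m + 1) ≤ n`, the distance to
the starting point increases strictly. -/
lemma strictMonoOn_dist_edgeParam_add {n : ℕ} (hn : 3 ≤ n) (a : ℝ) (m : ℕ)
    (hmn : 2 * m + 2 ≤ n) :
    StrictMonoOn (fun t => dist (edgeParam n a) (edgeParam n (a + t))) (Set.Icc 0 m) := by
  have hrot : ∀ t, dist (edgeParam n a) (edgeParam n (a + t)) =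
      dist (edgeParam n (Int.fract a)) (edgeParam n (Int.fract a + t)) := by
    intro t
    have h1 : edgeParam n a = nroot n ^ ⌊a⌋ * edgeParam n (Int.fract a) := by
      rw [← edgeParam_add_int, Int.fract_add_floor]
    have h2 : edgeParam n (a + t) = nroot n ^ ⌊a⌋ * edgeParam n (Int.fract a + t) := by
      rw [← edgeParam_add_int, add_right_comm, Int.fract_add_floor]
    rw [h1, h2, dist_eq_norm, dist_eq_norm, ← mul_sub, norm_mul, norm_nroot_zpow, one_mul]
  have hf0 := Int.fract_nonneg a
  have hf1 := Int.fract_lt_one a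
  intro t ht t' ht' hlt
  beta_reduce
  rw [hrot, hrot]
  exact strictMonoOn_dist_edgeParam hn ⟨hf0, hf1.le⟩ m hmn ⟨by linarith [ht.1], by linarith [ht.2]⟩
    ⟨by linarith [ht'.1], by linarith [ht'.2]⟩ (by linarith)

lemma dist_edgeParam_add_natCast (n m : ℕ) (a : ℝ) (hm : m ≤ n) :
    dist (edgeParam n a) (edgeParam n (a + m)) =
      2 * Real.sin (m * (Real.pi / n)) * ‖edgeParam n a‖ := by
  have h := edgeParam_add_int n a m
  rw [Int.cast_natCast] at h
  have hs := sin_mul_pi_div_nonneg (n := n) (x := m) (by positivity) (by exact_mod_cast hm)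
  have h1 : ‖1 - nroot n ^ (m : ℤ)‖ = 2 * Real.sin (m * (Real.pi / n)) := by
    rw [← sq_eq_sq₀ (norm_nonneg _) (by positivity), ← Complex.normSq_eq_norm_sq,
      Complex.normSq_apply, nroot_zpow]
    simp only [Int.cast_natCast, mul_assoc, Real.cos_two_mul, Real.sin_two_mul, Complex.sub_re,
      Complex.sub_im, Complex.one_re, Complex.one_im]
    have := Real.cos_sq_add_sin_sq (m * (Real.pi / n))
    grind
  rw [h, dist_eq_norm, ← h1, ← norm_mul]
  congr 1
  ring

lemma norm_edgeParam_sq (n : ℕ) {a : ℝ} (ha : a ∈ Set.Icc (0 : ℝ) 1) :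
    ‖edgeParam n a‖ ^ 2 = 1 - 4 * a * (1 - a) * Real.sin (Real.pi / n) ^ 2 := by
  rw [edgeParam_eq_of_mem_Icc n (k := 0) (by simpa using ha), ← Complex.normSq_eq_norm_sq,
    Complex.normSq_apply]
  have := Real.cos_sq_add_sin_sq (Real.pi / n)
  simp only [nroot_zpow]
  simp [Real.cos_two_mul, Real.sin_two_mul]
  grind

lemma norm_edgeParam_mem_Icc (n : ℕ) (a : ℝ) :
    ‖edgeParam n a‖ ∈ Set.Icc (Real.cos (Real.pi / n)) 1 := by
  have h1 : ‖edgeParam n a‖ = ‖edgeParam n (Int.fract a)‖ := by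
    conv_lhs => rw [← Int.fract_add_floor a, edgeParam_add_int, norm_mul, norm_nroot_zpow, one_mul]
  have hf0 := Int.fract_nonneg a
  have hf1 := (Int.fract_lt_one a).le
  have h := norm_edgeParam_sq n ⟨hf0, hf1⟩
  have hcs := Real.cos_sq_add_sin_sq (Real.pi / n)
  rw [h1]
  constructor
  · refine le_of_sq_le_sq ?_ (norm_nonneg _)
    rw [h]
    nlinarith [mul_nonneg (sq_nonneg (2 * Int.fract a - 1)) (sq_nonneg (Real.sin (Real.pi / n)))]
  · refine le_of_sq_le_sq ?_ zero_le_one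
    rw [h]
    nlinarith [mul_nonneg (mul_nonneg hf0 (sub_nonneg.2 hf1)) (sq_nonneg (Real.sin (Real.pi / n)))]

lemma exists_norm_edgeParam_eq {n : ℕ} (hn : 3 ≤ n) {ρ : ℝ}
    (hρ : ρ ∈ Set.Icc (Real.cos (Real.pi / n)) 1) : ∃ a, ‖edgeParam n a‖ = ρ := by
  have hn' : (3 : ℝ) ≤ n := by exact_mod_cast hn
  have hcos : 0 ≤ Real.cos (Real.pi / n) := by
    apply Real.cos_nonneg_of_neg_pi_div_two_le_of_le
    · have : 0 ≤ Real.pi / n := by positivity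
      linarith [Real.pi_pos]
    · exact div_le_div_of_nonneg_left Real.pi_pos.le (by norm_num) (by linarith)
  have hcs := Real.cos_sq_add_sin_sq (Real.pi / n)
  have hρ0 : 0 ≤ ρ := hcos.trans hρ.1
  have hivt := intermediate_value_Icc' (a := (0 : ℝ)) (b := 1 / 2) (by norm_num)
    (f := fun a => 1 - 4 * a * (1 - a) * Real.sin (Real.pi / n) ^ 2) (by fun_prop)
  obtain ⟨a, ha, h⟩ := @hivt (ρ ^ 2) (by
    constructor
    · nlinarith [hρ.1]
    · nlinarith [hρ.2])
  refine ⟨a, ?_⟩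
  rw [← sq_eq_sq₀ (norm_nonneg _) hρ0, norm_edgeParam_sq n ⟨ha.1, ha.2.trans (by norm_num)⟩]
  exact h

/-- For `n = q(2l+1)` with `l ≥ 1` and `q ≥ 2`, the set of side lengths `r > 0` of inscribed
equilateral `(2l+1)`-pointed stars in `P_n` is exactly the closed interval
`[2 sin(πl/(2l+1)) cos(π/n), 2 sin(πl/(2l+1))]`. -/
theorem star_side_length_range (l q : ℕ) (hl : 1 ≤ l) (hq : 2 ≤ q) (n : ℕ)
    (hn : n = q * (2 * l + 1)) :
    {r : ℝ | 0 < r ∧ ∃ p ∈ polygon n, ∃ u : ℕ → ℂ, IsStar n l r p u} =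
      Set.Icc (2 * Real.sin (Real.pi * l / (2 * l + 1)) * Real.cos (Real.pi / n))
        (2 * Real.sin (Real.pi * l / (2 * l + 1))) := by
  have hn3 : 3 ≤ n := by rw [hn]; nlinarith
  have hn0 : n ≠ 0 := by omega
  have hnpos : (0 : ℝ) < n := by positivity
  have hmpos : (0 : ℝ) < 2 * l + 1 := by positivity
  have hnR : (n : ℝ) = q * (2 * l + 1) := by rw [hn]; push_cast; ring
  have hql : 2 * (q * l) + 2 ≤ n := by rw [hn]; nlinarith
  have hqn : ((q * l : ℕ) : ℝ) / n = l / (2 * l + 1) := by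
    rw [hnR]
    have : (q : ℝ) ≠ 0 := by
      have : q ≠ 0 := by omega
      exact_mod_cast this
    push_cast
    field_simp
  have hqn' : n * (l / (2 * l + 1) : ℝ) = (q * l : ℕ) := by
    rw [← hqn, mul_div_cancel₀ _ hnpos.ne']
  have hangle : Real.pi * l / (2 * l + 1) = (q * l : ℕ) * (Real.pi / n) := by
    rw [mul_div_assoc, ← hqn]
    ring
  have hqlpos : 0 < q * l := by positivity
  have hfrac : Int.fract (((q * l : ℕ) : ℝ) / n) = l / (2 * l + 1) := by
    rw [hqn, Int.fract_eq_self, div_lt_one hmpos]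
    exact ⟨by positivity, by linarith [(Nat.cast_nonneg l : (0 : ℝ) ≤ l)]⟩
  have hlm : 0 < (l / (2 * l + 1) : ℝ) := by positivity
  rw [hangle]
  set S := Real.sin ((q * l : ℕ) * (Real.pi / n))
  have hSpos : 0 < S := sin_mul_pi_div_pos (by exact_mod_cast hqlpos)
    (by exact_mod_cast (by omega : q * l < n))
  have hcos : 0 < Real.cos (Real.pi / n) := by
    have hn' : (3 : ℝ) ≤ n := by exact_mod_cast hn3
    apply Real.cos_pos_of_mem_Ioo
    constructor
    · have : 0 < Real.pi / n := by positivity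
      linarith [Real.pi_pos]
    · exact div_lt_div_of_pos_left Real.pi_pos (by norm_num) (by linarith)
  have hdist : ∀ a, dist (edgeParam n a) (edgeParam n (a + (q * l : ℕ))) =
      2 * S * ‖edgeParam n a‖ := fun a => dist_edgeParam_add_natCast n (q * l) a (by omega)
  have hmono := fun a => strictMonoOn_dist_edgeParam_add hn3 a (q * l) hql
  have hpd : ∀ a, polyDist n (edgeParam n a) (edgeParam n (a + (q * l : ℕ))) = l / (2 * l + 1) :=
    fun a => by rw [polyDist_edgeParam hn3, add_sub_cancel_left, hfrac]
  have hsum : ∑ i ∈ Finset.range (2 * l + 1), (l / (2 * l + 1) : ℝ) = l := by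
    rw [Finset.sum_const, Finset.card_range, nsmul_eq_mul]
    push_cast
    field_simp
  have hne : (Finset.range (2 * l + 1)).Nonempty := ⟨0, by simp⟩
  have hend : (0 : ℝ) ≤ (q * l : ℕ) := Nat.cast_nonneg _
  ext r
  constructor
  · rintro ⟨-, p, -, u, -, -, hu, hud, hub, hus⟩
    constructor
    · obtain ⟨i, hi, hle⟩ := Finset.exists_le_of_sum_le hne (hsum.trans hus.symm).le
      rw [Finset.mem_range] at hi
      obtain ⟨a, ha⟩ := exists_edgeParam_eq (hu i (by omega))
      have hlow : 2 * S * Real.cos (Real.pi / n) ≤ 2 * S * ‖edgeParam n a‖ :=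
        mul_le_mul_of_nonneg_left (norm_edgeParam_mem_Icc n a).1 (by positivity)
      refine hlow.trans ?_
      rw [← hdist a]
      rcases hle.eq_or_lt with heq | hlt
      · obtain ⟨b, hb⟩ := exists_edgeParam_eq (hu (i + 1) (by omega))
        have h := edgeParam_add_polyDist hn3 a b
        rw [ha, hb, ← heq, hqn'] at h
        rw [ha, h, hud i (by omega)]
      · rw [ha]
        refine (hub i (by omega) _ (edgeParam_mem_polygon hn0 _) ?_).le
        rw [SCCWBtw, ← ha, hpd a, ha]
        exact ⟨hlm, hlt⟩
    · obtain ⟨i, hi, hle⟩ := Finset.exists_le_of_sum_le hne (hus.trans hsum.symm).le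
      rw [Finset.mem_range] at hi
      obtain ⟨a, ha⟩ := exists_edgeParam_eq (hu i (by omega))
      obtain ⟨b, hb⟩ := exists_edgeParam_eq (hu (i + 1) (by omega))
      have hup : 2 * S * ‖edgeParam n a‖ ≤ 2 * S :=
        mul_le_of_le_one_right (by positivity) (norm_edgeParam_mem_Icc n a).2
      refine le_trans ?_ hup
      have h := edgeParam_add_polyDist hn3 a b
      rw [ha, hb] at h
      rw [← hdist a, ← hud i (by omega), ← h, ← ha]
      have hle' : n * polyDist n (u i) (u (i + 1)) ≤ (q * l : ℕ) := by
        rw [← hqn']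
        exact mul_le_mul_of_nonneg_left hle hnpos.le
      rw [← ha] at hle'
      exact (hmono a).monotoneOn ⟨mul_nonneg hnpos.le (Int.fract_nonneg _), hle'⟩
        ⟨hend, le_rfl⟩ hle'
  · rintro ⟨hr1, hr2⟩
    have hr : 0 < r := lt_of_lt_of_le (by positivity) hr1
    obtain ⟨a, ha⟩ := exists_norm_edgeParam_eq hn3 (ρ := r / (2 * S))
      ⟨by rw [le_div_iff₀ (by positivity)]; linarith, by rw [div_le_one (by positivity)]; exact hr2⟩
    let v : ℕ → ℝ := fun i => a + ((q * l * i : ℕ) : ℤ)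
    have hv : ∀ i, v (i + 1) = v i + (q * l : ℕ) := fun i => by
      simp only [v]; push_cast; ring
    have hvn : ∀ i, ‖edgeParam n (v i)‖ = r / (2 * S) := fun i => by
      simp only [v]
      rw [edgeParam_add_int, norm_mul, norm_nroot_zpow, one_mul, ha]
    have hvd : ∀ i, dist (edgeParam n (v i)) (edgeParam n (v i + (q * l : ℕ))) = r := fun i => by
      rw [hdist, hvn, mul_div_cancel₀ _ (by positivity)]
    refine ⟨hr, edgeParam n a, edgeParam_mem_polygon hn0 a, fun i => edgeParam n (v i),
      ?_, ?_, fun i _ => edgeParam_mem_polygon hn0 _, fun i _ => ?_, fun i _ z hz hbt => ?_, ?_⟩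
    · simp [v]
    · have : v (2 * l + 1) = a + n * (l : ℤ) := by
        simp only [v, hnR]; push_cast; ring
      beta_reduce
      rw [this, edgeParam_add_mul hn0]
    · beta_reduce
      rw [hv, hvd]
    · obtain ⟨b, rfl⟩ := exists_edgeParam_eq hz
      beta_reduce at hbt ⊢
      rw [SCCWBtw, hv, hpd] at hbt
      obtain ⟨h0, h1⟩ := hbt
      have h2 : n * polyDist n (edgeParam n (v i)) (edgeParam n b) < (q * l : ℕ) := by
        rw [← hqn']
        exact mul_lt_mul_of_pos_left h1 hnpos
      rw [← hvd i, ← edgeParam_add_polyDist hn3 (v i) b]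
      exact hmono (v i) ⟨(mul_pos hnpos h0).le, h2.le⟩ ⟨hend, le_rfl⟩ h2
    · simp only [hv, hpd]
      exact hsum
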